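/- arXiv:1502.07953 — 4 statements merged into one kernel-verified Lean document; each statement's English description precedes it below -/
import Mathlib

section
/- (Gauss) For a positive integer n: F̃₁(n) = F̃(n) when n ≡ 7 (mod 8) or n = 3; F̃₁(n) = F̃(n)/3 when n ≡ 3 (mod 8) and n ≠ 3; and F̃₁(n) = 0 when n ≢ 3 (mod 4). -/
open scoped Classical

/-- A classical binary quadratic form `(a, 2b, c)`, i.e. `a x² + 2 b x y + c y²`,
stored as the triple `(a, b, c)` of integers. -/
structure ClassicalForm where
  a : ℤ
  b : ℤ
  c : ℤ

namespace ClassicalForm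

/-- The value `a x² + 2 b x y + c y²` of the form at `(x, y)`. -/
def eval (f : ClassicalForm) (x y : ℤ) : ℤ :=
  f.a * x ^ 2 + 2 * f.b * x * y + f.c * y ^ 2

/-- The determinant `D = b² - a c` of the form `(a, 2b, c)`. -/
def det (f : ClassicalForm) : ℤ := f.b ^ 2 - f.a * f.c

/-- Positive definite: negative determinant and `a > 0`. -/
def PosDef (f : ClassicalForm) : Prop := f.det < 0 ∧ 0 < f.a

/-- The divisor `δ = gcd(a, b, c)` of the form `(a, 2b, c)`. -/
def divisor (f : ClassicalForm) : ℕ := Int.gcd (Int.gcd f.a f.b) f.c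

/-- Primitive: divisor `gcd(a, b, c) = 1`. -/
def Primitive (f : ClassicalForm) : Prop := f.divisor = 1

/-- A form of divisor `δ` is *uneven* if its primitive part `(a/δ, 2b/δ, c/δ)`
satisfies `gcd(a/δ, 2b/δ, c/δ) = 1` (i.e. `a/δ`, `c/δ` are not both even);
equivalently, `gcd(a, 2b, c) = gcd(a, b, c)`. -/
def Uneven (f : ClassicalForm) : Prop :=
  Int.gcd (Int.gcd f.a (2 * f.b)) f.c = f.divisor

/-- A form of divisor `δ` is *even* if its primitive part `(a/δ, 2b/δ, c/δ)`
has both outer coefficients even; equivalently `gcd(a, 2b, c) = 2 gcd(a, b, c)`. -/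
def EvenForm (f : ClassicalForm) : Prop :=
  Int.gcd (Int.gcd f.a (2 * f.b)) f.c = 2 * f.divisor

/-- Proper equivalence: `g` is obtained from `f` by a change of variables of
determinant `1` (i.e. with matrix in `SL₂(ℤ)`). -/
def Equiv (f g : ClassicalForm) : Prop :=
  ∃ p q r s : ℤ, p * s - q * r = 1 ∧
    ∀ x y : ℤ, g.eval x y = f.eval (p * x + q * y) (r * x + s * y)

end ClassicalForm

/-- The number of proper equivalence classes of forms in a set `S` of classical
forms (the sets used below are closed under proper equivalence). -/
noncomputable def classCount (S : Set ClassicalForm) : ℕ :=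
  Nat.card (Quot (fun f g : S => ClassicalForm.Equiv f.1 g.1))

/-- `F n`: the number of proper equivalence classes of positive definite uneven
forms (primitive or derived) of determinant `-n`. -/
noncomputable def F (n : ℕ) : ℕ :=
  classCount {f | f.det = -(n : ℤ) ∧ f.PosDef ∧ f.Uneven}

/-- `F₁ n`: the number of proper equivalence classes of positive definite even
forms (primitive or derived) of determinant `-n`. -/
noncomputable def F₁ (n : ℕ) : ℕ :=
  classCount {f | f.det = -(n : ℤ) ∧ f.PosDef ∧ f.EvenForm}

/-- `F̃ n`: the number of proper equivalence classes of positive definite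
primitive uneven forms of determinant `-n`. -/
noncomputable def Ftil (n : ℕ) : ℕ :=
  classCount {f | f.det = -(n : ℤ) ∧ f.PosDef ∧ f.Primitive ∧ f.Uneven}

/-- `F̃₁ n`: the number of proper equivalence classes of positive definite
primitive even forms of determinant `-n`. -/
noncomputable def Ftil₁ (n : ℕ) : ℕ :=
  classCount {f | f.det = -(n : ℤ) ∧ f.PosDef ∧ f.Primitive ∧ f.EvenForm}

/-- The weighted count `F(n)`: every class counts `1`, except that the class of
`(t, 0, t)` (of determinant `-t²`) counts `1/2`. -/
noncomputable def Fw (n : ℕ) : ℚ :=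
  (F n : ℚ) - if ∃ t : ℕ, 0 < t ∧ n = t ^ 2 then 1 / 2 else 0

/-- The weighted count `F₁(n)`: every class counts `1`, except that the class of
`(2t, 2t, 2t)` (of determinant `-3t²`) counts `1/3`. -/
noncomputable def F₁w (n : ℕ) : ℚ :=
  (F₁ n : ℚ) - if ∃ t : ℕ, 0 < t ∧ n = 3 * t ^ 2 then 2 / 3 else 0

/-- A modern binary quadratic form `a x² + b x y + c y²`. -/
structure ModernForm where
  a : ℤ
  b : ℤ
  c : ℤ

namespace ModernForm

/-- The value `a x² + b x y + c y²` of the form at `(x, y)`. -/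
def eval (f : ModernForm) (x y : ℤ) : ℤ :=
  f.a * x ^ 2 + f.b * x * y + f.c * y ^ 2

/-- The discriminant `Δ = b² - 4 a c`. -/
def disc (f : ModernForm) : ℤ := f.b ^ 2 - 4 * f.a * f.c

/-- Positive definite: negative discriminant and `a > 0`. -/
def PosDef (f : ModernForm) : Prop := f.disc < 0 ∧ 0 < f.a

/-- Primitive: `gcd(a, b, c) = 1`. -/
def Primitive (f : ModernForm) : Prop := Int.gcd (Int.gcd f.a f.b) f.c = 1

/-- `SL₂(ℤ)`-equivalence of modern forms. -/
def Equiv (f g : ModernForm) : Prop :=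
  ∃ p q r s : ℤ, p * s - q * r = 1 ∧
    ∀ x y : ℤ, g.eval x y = f.eval (p * x + q * y) (r * x + s * y)

end ModernForm

/-- The class number `h(Δ)`: the number of `SL₂(ℤ)`-equivalence classes of
primitive positive definite modern forms of discriminant `Δ`. -/
noncomputable def h (Δ : ℤ) : ℕ :=
  Nat.card (Quot (fun f g : {f : ModernForm // f.disc = Δ ∧ f.PosDef ∧ f.Primitive} =>
    ModernForm.Equiv f.1 g.1))

/-- `h_ω(Δ)`: equal to `h(Δ)` except `h_ω(-3) = 1/3` and `h_ω(-4) = 1/2`. -/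
noncomputable def hω (Δ : ℤ) : ℚ :=
  if Δ = -3 then 1 / 3 else if Δ = -4 then 1 / 2 else (h Δ : ℚ)

/-- The Hurwitz class number `H(n) = Σ_{t | f} h_ω(Δ/t²)`, where `Δ = -n = f² Δ₁`
with `Δ₁` a fundamental discriminant; equivalently, the sum of `h_ω(-(n/t²))`
over all `t ≥ 1` with `t² ∣ n` and `-(n/t²) ≡ 0` or `1 (mod 4)`. -/
noncomputable def Hur (n : ℕ) : ℚ :=
  ∑ t ∈ (Finset.Icc 1 n).filter (fun t =>
      t ^ 2 ∣ n ∧ ((-((n / t ^ 2 : ℕ) : ℤ)) % 4 = 0 ∨ (-((n / t ^ 2 : ℕ) : ℤ)) % 4 = 1)),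
    hω (-((n / t ^ 2 : ℕ) : ℤ))

namespace ClassicalForm

/-- `g` is obtained from `f` by the change of variables with matrix `(p, q; r, s)` in `SL₂(ℤ)`. -/
def Via (f g : ClassicalForm) (p q r s : ℤ) : Prop :=
  p * s - q * r = 1 ∧ g.a = f.a * p ^ 2 + 2 * f.b * p * r + f.c * r ^ 2 ∧
    g.b = f.a * p * q + f.b * (p * s + q * r) + f.c * r * s ∧
    g.c = f.a * q ^ 2 + 2 * f.b * q * s + f.c * s ^ 2

theorem equiv_iff_exists_via (f g : ClassicalForm) :
    Equiv f g ↔ ∃ p q r s : ℤ, Via f g p q r s := by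
  constructor
  · rintro ⟨p, q, r, s, hd, h⟩
    have h1 := h 1 0
    have h2 := h 0 1
    have h3 := h 1 1
    simp only [eval] at h1 h2 h3
    exact ⟨p, q, r, s, hd, by linarith, by linarith, by linarith⟩
  · rintro ⟨p, q, r, s, hd, h1, h2, h3⟩
    refine ⟨p, q, r, s, hd, fun x y => ?_⟩
    simp only [eval, h1, h2, h3]
    ring

theorem Via.trans {f g k : ClassicalForm} {p q r s p' q' r' s' : ℤ}
    (h : Via f g p q r s) (h' : Via g k p' q' r' s') :
    Via f k (p * p' + q * r') (p * q' + q * s') (r * p' + s * r') (r * q' + s * s') := by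
  obtain ⟨h0, h1, h2, h3⟩ := h
  obtain ⟨k0, k1, k2, k3⟩ := h'
  refine ⟨by linear_combination (p' * s' - q' * r') * h0 + k0, ?_, ?_, ?_⟩
  · rw [k1, h1, h2, h3]; ring
  · rw [k2, h1, h2, h3]; ring
  · rw [k3, h1, h2, h3]; ring

theorem Via.symm {f g : ClassicalForm} {p q r s : ℤ} (h : Via f g p q r s) :
    Via g f s (-q) (-r) p := by
  obtain ⟨h0, h1, h2, h3⟩ := h
  have e : p * s - q * r + 1 = 2 := by rw [h0]; rfl
  refine ⟨by linarith, ?_, ?_, ?_⟩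
  · rw [h1, h2, h3]
    linear_combination (-f.a * (p * s - q * r + 1)) * h0
  · rw [h1, h2, h3]
    linear_combination (-f.b * (p * s - q * r + 1)) * h0
  · rw [h1, h2, h3]
    linear_combination (-f.c * (p * s - q * r + 1)) * h0

theorem equivalence_equiv : Equivalence Equiv := by
  refine ⟨fun f => (equiv_iff_exists_via f f).2 ⟨1, 0, 0, 1, ?_⟩, fun {f g} h => ?_,
    fun {f g k} h h' => ?_⟩
  · refine ⟨by ring, by ring, by ring, by ring⟩
  · obtain ⟨p, q, r, s, h⟩ := (equiv_iff_exists_via f g).1 h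
    exact (equiv_iff_exists_via g f).2 ⟨_, _, _, _, h.symm⟩
  · obtain ⟨p, q, r, s, h⟩ := (equiv_iff_exists_via f g).1 h
    obtain ⟨p', q', r', s', h'⟩ := (equiv_iff_exists_via g k).1 h'
    exact (equiv_iff_exists_via f k).2 ⟨_, _, _, _, h.trans h'⟩

/-- The coefficients of `f` generate the unit ideal. -/
def Bezout (f : ClassicalForm) : Prop :=
  ∃ x y z : ℤ, f.a * x + f.b * y + f.c * z = 1

theorem primitive_iff_bezout (f : ClassicalForm) : f.Primitive ↔ f.Bezout := by
  unfold Primitive divisor Bezout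
  constructor
  · intro h
    have h1 := Int.gcd_eq_gcd_ab f.a f.b
    have h2 := Int.gcd_eq_gcd_ab (Int.gcd f.a f.b) f.c
    rw [h] at h2
    set u := Int.gcdA f.a f.b
    set v := Int.gcdB f.a f.b
    set t := Int.gcdA (Int.gcd f.a f.b) f.c
    set w := Int.gcdB (Int.gcd f.a f.b) f.c
    rw [h1] at h2
    push_cast at h2
    exact ⟨u * t, v * t, w, by linear_combination -h2⟩
  · rintro ⟨x, y, z, h⟩
    have hg : ((Int.gcd (Int.gcd f.a f.b) f.c : ℕ) : ℤ) ∣ 1 := by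
      rw [← h]
      have hab : ((Int.gcd (Int.gcd f.a f.b) f.c : ℕ) : ℤ) ∣ (Int.gcd f.a f.b : ℕ) :=
        Int.gcd_dvd_left _ _
      refine dvd_add (dvd_add ?_ ?_) ?_
      · exact ((hab.trans (Int.gcd_dvd_left _ _))).mul_right _
      · exact ((hab.trans (Int.gcd_dvd_right _ _))).mul_right _
      · exact (Int.gcd_dvd_right _ _).mul_right _
    exact Nat.dvd_one.1 (by exact_mod_cast hg)

theorem even_gcd_iff (f : ClassicalForm) :
    2 ∣ Int.gcd (Int.gcd f.a (2 * f.b)) f.c ↔ Even f.a ∧ Even f.c := by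
  rw [even_iff_two_dvd, even_iff_two_dvd]
  constructor
  · intro h
    have h' : (2 : ℤ) ∣ (Int.gcd (Int.gcd f.a (2 * f.b)) f.c : ℕ) := by exact_mod_cast h
    exact ⟨(h'.trans (Int.gcd_dvd_left _ _)).trans (Int.gcd_dvd_left _ _),
      h'.trans (Int.gcd_dvd_right _ _)⟩
  · rintro ⟨h1, h2⟩
    have h3 : (2 : ℤ) ∣ (Int.gcd f.a (2 * f.b) : ℕ) :=
      Int.dvd_coe_gcd h1 (dvd_mul_right _ _)
    have h4 : (2 : ℤ) ∣ (Int.gcd (Int.gcd f.a (2 * f.b)) f.c : ℕ) := Int.dvd_coe_gcd h3 h2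
    exact_mod_cast h4

theorem gcd_dvd_two {f : ClassicalForm} (h : f.Bezout) :
    Int.gcd (Int.gcd f.a (2 * f.b)) f.c ∣ 2 := by
  obtain ⟨x, y, z, h⟩ := h
  have hg : ((Int.gcd (Int.gcd f.a (2 * f.b)) f.c : ℕ) : ℤ) ∣ 2 := by
    have e : f.a * (2 * x) + 2 * f.b * y + f.c * (2 * z) = 2 := by
      linear_combination 2 * h
    refine Dvd.dvd.trans ?_ e.dvd
    have hab : ((Int.gcd (Int.gcd f.a (2 * f.b)) f.c : ℕ) : ℤ) ∣ (Int.gcd f.a (2 * f.b) : ℕ) :=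
      Int.gcd_dvd_left _ _
    refine dvd_add (dvd_add ?_ ?_) ?_
    · exact ((hab.trans (Int.gcd_dvd_left _ _))).mul_right _
    · exact ((hab.trans (Int.gcd_dvd_right _ _))).mul_right _
    · exact (Int.gcd_dvd_right _ _).mul_right _
  exact_mod_cast hg

/-- Positive definite primitive even forms of determinant `-n`, by congruence conditions. -/
def IsE (n : ℕ) (f : ClassicalForm) : Prop :=
  f.det = -(n : ℤ) ∧ 0 < f.a ∧ f.Bezout ∧ Even f.a ∧ Even f.c

/-- Positive definite primitive uneven forms of determinant `-n`, by congruence conditions. -/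
def IsU (n : ℕ) (f : ClassicalForm) : Prop :=
  f.det = -(n : ℤ) ∧ 0 < f.a ∧ f.Bezout ∧ ¬(Even f.a ∧ Even f.c)

theorem isE_iff {n : ℕ} (hn : 0 < n) (f : ClassicalForm) :
    (f.det = -(n : ℤ) ∧ f.PosDef ∧ f.Primitive ∧ f.EvenForm) ↔ IsE n f := by
  unfold IsE PosDef EvenForm
  rw [← even_gcd_iff]
  constructor
  · rintro ⟨h1, ⟨-, h2⟩, h3, h4⟩
    refine ⟨h1, h2, (primitive_iff_bezout f).1 h3, ?_⟩
    rw [h4]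
    exact dvd_mul_right _ _
  · rintro ⟨h1, h2, h3, h4⟩
    have h3' := (primitive_iff_bezout f).2 h3
    refine ⟨h1, ⟨by omega, h2⟩, h3', ?_⟩
    rw [show f.divisor = 1 from h3']
    exact Nat.dvd_antisymm (gcd_dvd_two h3) h4

theorem isU_iff {n : ℕ} (hn : 0 < n) (f : ClassicalForm) :
    (f.det = -(n : ℤ) ∧ f.PosDef ∧ f.Primitive ∧ f.Uneven) ↔ IsU n f := by
  unfold IsU PosDef Uneven
  rw [← even_gcd_iff]
  constructor
  · rintro ⟨h1, ⟨-, h2⟩, h3, h4⟩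
    refine ⟨h1, h2, (primitive_iff_bezout f).1 h3, ?_⟩
    rw [h4, show f.divisor = 1 from h3]
    decide
  · rintro ⟨h1, h2, h3, h4⟩
    have h3' := (primitive_iff_bezout f).2 h3
    refine ⟨h1, ⟨by omega, h2⟩, h3', ?_⟩
    rw [show f.divisor = 1 from h3']
    rcases (Nat.dvd_prime Nat.prime_two).1 (gcd_dvd_two h3) with h | h
    · exact h
    · exact absurd (dvd_of_eq h.symm) h4

theorem IsE.odd_b {n : ℕ} {f : ClassicalForm} (hf : IsE n f) : Odd f.b := by
  obtain ⟨-, -, ⟨x, y, z, h⟩, ⟨A, hA⟩, ⟨C, hC⟩⟩ := hf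
  by_contra hb
  obtain ⟨k, hk⟩ := Int.not_odd_iff_even.1 hb
  rw [hA, hC, hk] at h
  have : 2 * (A * x + k * y + C * z) = 1 := by linear_combination h
  omega

theorem Via.bezout {f g : ClassicalForm} {p q r s : ℤ} (h : Via f g p q r s)
    (hf : f.Bezout) : g.Bezout := by
  obtain ⟨x, y, z, e⟩ := hf
  obtain ⟨-, h1, h2, h3⟩ := h.symm
  refine ⟨s ^ 2 * x - s * q * y + q ^ 2 * z,
    -2 * s * r * x + (s * p + q * r) * y - 2 * q * p * z, r ^ 2 * x - r * p * y + p ^ 2 * z, ?_⟩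
  rw [h1, h2, h3] at e
  linear_combination e

theorem Via.even {f g : ClassicalForm} {p q r s : ℤ} (h : Via f g p q r s)
    (hf : Even f.a ∧ Even f.c) : Even g.a ∧ Even g.c := by
  obtain ⟨⟨A, hA⟩, ⟨C, hC⟩⟩ := hf
  obtain ⟨-, h1, -, h3⟩ := h
  rw [h1, h3, hA, hC]
  exact ⟨⟨A * p ^ 2 + f.b * p * r + C * r ^ 2, by ring⟩,
    ⟨A * q ^ 2 + f.b * q * s + C * s ^ 2, by ring⟩⟩

theorem Via.det {f g : ClassicalForm} {p q r s : ℤ} (h : Via f g p q r s) : g.det = f.det := by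
  obtain ⟨h0, h1, h2, h3⟩ := h
  unfold ClassicalForm.det
  rw [h1, h2, h3]
  linear_combination (f.b ^ 2 - f.a * f.c) * (p * s - q * r + 1) * h0

theorem Via.pos {f g : ClassicalForm} {p q r s : ℤ} (h : Via f g p q r s)
    (hd : f.det < 0) (ha : 0 < f.a) : 0 < g.a := by
  obtain ⟨h0, h1, -, -⟩ := h
  have e : f.a * g.a = (f.a * p + f.b * r) ^ 2 + (-f.det) * r ^ 2 := by
    rw [h1, ClassicalForm.det]; ring
  have : 0 < f.a * g.a := by
    rw [e]
    rcases eq_or_ne r 0 with hr | hr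
    · subst hr
      have hp : p ≠ 0 := by rintro rfl; simp at h0
      have := ha.ne'
      simp only [mul_zero, add_zero, zero_pow two_ne_zero]
      positivity
    · have : 0 < -f.det := by omega
      positivity
  exact pos_of_mul_pos_right this ha.le

theorem Via.isE {n : ℕ} (hn : 0 < n) {f g : ClassicalForm} {p q r s : ℤ}
    (h : Via f g p q r s) (hf : IsE n f) : IsE n g :=
  ⟨h.det.trans hf.1, h.pos (by rw [hf.1]; omega) hf.2.1, h.bezout hf.2.2.1, h.even hf.2.2.2⟩

theorem Via.isU {n : ℕ} (hn : 0 < n) {f g : ClassicalForm} {p q r s : ℤ}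
    (h : Via f g p q r s) (hf : IsU n f) : IsU n g :=
  ⟨h.det.trans hf.1, h.pos (by rw [hf.1]; omega) hf.2.1, h.bezout hf.2.2.1,
    fun hg => hf.2.2.2 (h.symm.even hg)⟩

/-- Even forms `(2A, 2B, 2C)` with `C` odd. -/
def IsE0 (n : ℕ) (f : ClassicalForm) : Prop := IsE n f ∧ Odd (f.c / 2)

/-- The form `(4A, 2B, C)` attached to `(2A, 2B, 2C)`. -/
def restrict (f : ClassicalForm) : ClassicalForm := ⟨2 * f.a, f.b, f.c / 2⟩

theorem IsE0.isU_restrict {n : ℕ} {f : ClassicalForm} (hf : IsE0 n f) : IsU n f.restrict := by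
  obtain ⟨⟨h1, h2, ⟨x, y, z, h3⟩, ⟨A, hA⟩, ⟨C, hC⟩⟩, h4⟩ := hf
  have e : f.c / 2 = C := by omega
  refine ⟨?_, ?_, ?_, fun h => Int.not_even_iff_odd.2 h4 h.2⟩
  · rw [← h1]
    simp only [ClassicalForm.det, restrict, e]
    rw [hC]; ring
  · simp only [restrict]; omega
  · refine ⟨x ^ 2 * A + 2 * x * z * C, 2 * y - y ^ 2 * f.b, 4 * z ^ 2 * C, ?_⟩
    simp only [restrict, e]
    rw [hA, hC] at h3
    rw [hA]
    linear_combination ((A + A) * x + (C + C) * z + 1 - f.b * y) * h3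

theorem restrict_equiv_iff {n : ℕ} {f g : ClassicalForm} (hf : IsE0 n f) (hg : IsE0 n g) :
    Equiv f.restrict g.restrict ↔ ∃ p q r s : ℤ, Via f g p (2 * q) r s := by
  obtain ⟨⟨-, -, -, ⟨A, hA⟩, ⟨C, hC⟩⟩, hf4⟩ := hf
  obtain ⟨⟨-, -, -, ⟨A', hA'⟩, ⟨C', hC'⟩⟩, hg4⟩ := hg
  have e : f.c / 2 = C := by omega
  have e' : g.c / 2 = C' := by omega
  rw [equiv_iff_exists_via]
  simp only [Via, restrict, e, e']
  simp only [hA, hA', hC, hC']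
  rw [e] at hf4
  constructor
  · rintro ⟨p, q, r, s, h0, h1, h2, h3⟩
    have hr : Even r := by
      have : Even (C * r ^ 2) :=
        ⟨2 * A' - 2 * A * p ^ 2 - f.b * p * r, by linear_combination -h1⟩
      rcases Int.even_mul.1 this with h | h
      · exact absurd h (Int.not_even_iff_odd.2 hf4)
      · exact (Int.even_pow.1 h).1
    obtain ⟨k, rfl⟩ := hr
    refine ⟨p, q, k, s, by linear_combination h0, ?_, by linear_combination h2,
      by linear_combination 2 * h3⟩
    have : 2 * (A' + A') = 2 * ((A + A) * p ^ 2 + 2 * f.b * p * k + (C + C) * k ^ 2) := by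
      linear_combination h1
    omega
  · rintro ⟨p, q, r, s, h0, h1, h2, h3⟩
    refine ⟨p, q, 2 * r, s, by linear_combination h0, by linear_combination 2 * h1,
      by linear_combination h2, ?_⟩
    have : 2 * C' = 2 * (2 * (A + A) * q ^ 2 + 2 * f.b * q * s + C * s ^ 2) := by
      linear_combination h3
    omega

theorem via_swap (f : ClassicalForm) : Via f ⟨f.c, -f.b, f.a⟩ 0 (-1) 1 0 :=
  ⟨by ring, by ring, by ring, by ring⟩

theorem via_shear (f : ClassicalForm) : Via f ⟨f.a, f.a + f.b, f.a + 2 * f.b + f.c⟩ 1 1 0 1 :=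
  ⟨by ring, by ring, by ring, by ring⟩

theorem via_shear' (f : ClassicalForm) : Via f ⟨f.a + 2 * f.b + f.c, f.b + f.c, f.c⟩ 1 0 1 1 :=
  ⟨by ring, by ring, by ring, by ring⟩

theorem IsE.exists_isE0 {n : ℕ} (hn : 0 < n) {f : ClassicalForm} (hf : IsE n f) :
    ∃ g, IsE0 n g ∧ Equiv f g := by
  obtain ⟨A, hA⟩ := hf.2.2.2.1
  obtain ⟨C, hC⟩ := hf.2.2.2.2
  obtain ⟨k, hk⟩ := hf.odd_b
  rcases Int.even_or_odd C with hC' | hC'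
  · rcases Int.even_or_odd A with hA' | hA'
    · refine ⟨_, ⟨(via_shear f).isE hn hf, ?_⟩,
        (equiv_iff_exists_via _ _).2 ⟨_, _, _, _, via_shear f⟩⟩
      obtain ⟨i, hi⟩ := hA'
      obtain ⟨j, hj⟩ := hC'
      exact ⟨i + j + k, by simp only; omega⟩
    · refine ⟨_, ⟨(via_swap f).isE hn hf, ?_⟩,
        (equiv_iff_exists_via _ _).2 ⟨_, _, _, _, via_swap f⟩⟩
      rw [show (⟨f.c, -f.b, f.a⟩ : ClassicalForm).c / 2 = A by simp only; omega]
      exact hA'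
  · refine ⟨f, ⟨hf, ?_⟩, equivalence_equiv.refl f⟩
    rw [show f.c / 2 = C by omega]
    exact hC'

theorem IsU.exists_even_a {n : ℕ} (hn : 0 < n) {f : ClassicalForm}
    (hf : IsU n f) : ∃ g, IsU n g ∧ Even g.a ∧ Equiv f g := by
  rcases Int.even_or_odd f.a with ha | ha
  · exact ⟨f, hf, ha, equivalence_equiv.refl f⟩
  rcases Int.even_or_odd f.c with hc | hc
  · exact ⟨_, (via_swap f).isU hn hf, hc, (equiv_iff_exists_via _ _).2 ⟨_, _, _, _, via_swap f⟩⟩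
  · refine ⟨_, (via_shear' f).isU hn hf, ?_,
      (equiv_iff_exists_via _ _).2 ⟨_, _, _, _, via_shear' f⟩⟩
    obtain ⟨i, hi⟩ := ha
    obtain ⟨j, hj⟩ := hc
    exact ⟨i + j + 1 + f.b, by simp only; omega⟩

theorem IsU.exists_restrict {n : ℕ} (hn : 0 < n) (hn2 : n % 4 = 3) {f : ClassicalForm}
    (hf : IsU n f) : ∃ g, IsE0 n g ∧ Equiv g.restrict f := by
  obtain ⟨g, hg, ha, hfg⟩ := hf.exists_even_a hn
  have hc : Odd g.c := by
    by_contra h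
    exact hg.2.2.2 ⟨ha, Int.not_odd_iff_even.1 h⟩
  obtain ⟨h1, h2, ⟨x, y, z, h3⟩, -⟩ := hg
  obtain ⟨m, hm⟩ : ∃ m, n = 4 * m + 3 := ⟨n / 4, by omega⟩
  obtain ⟨A, hA⟩ := ha
  have hb : Odd g.b := by
    by_contra hb
    obtain ⟨k, hk⟩ := Int.not_odd_iff_even.1 hb
    rw [ClassicalForm.det, hA, hk, hm] at h1
    push_cast at h1
    have : 2 * (2 * k ^ 2 - A * g.c + 2 * m + 1) = -1 := by linear_combination h1
    omega
  obtain ⟨k, hk⟩ := hb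
  have hA2 : Even A := by
    have : Even (A * g.c) := by
      rw [ClassicalForm.det, hA, hk, hm] at h1
      push_cast at h1
      have : 2 * (A * g.c) = 2 * (2 * (k ^ 2 + k + m + 1)) := by linear_combination -h1
      exact ⟨k ^ 2 + k + m + 1, by omega⟩
    rcases Int.even_mul.1 this with h | h
    · exact h
    · exact absurd h (Int.not_even_iff_odd.2 hc)
  have e : (2 * g.c) / 2 = g.c := by omega
  refine ⟨⟨A, g.b, 2 * g.c⟩, ⟨⟨?_, ?_, ?_, hA2, even_two_mul _⟩, ?_⟩, ?_⟩
  · rw [← h1, ClassicalForm.det, ClassicalForm.det, hA]; ring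
  · simp only; omega
  · refine ⟨-4 * k * x, 1 - 2 * k * y, - k * z, ?_⟩
    simp only
    rw [hA] at h3
    linear_combination -2 * k * h3 + hk
  · simp only [e]; exact hc
  · have : (⟨A, g.b, 2 * g.c⟩ : ClassicalForm).restrict = g := by
      cases g
      simp only [restrict, mk.injEq, true_and] at *
      omega
    rw [this]
    exact equivalence_equiv.symm hfg

theorem IsE0.exists_via_even_of_mod_eight {n : ℕ} (hn : n % 8 = 7) {f g : ClassicalForm}
    (hf : IsE0 n f) (hg : IsE0 n g) (h : Equiv f g) :
    ∃ p q r s : ℤ, Via f g p (2 * q) r s := by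
  obtain ⟨p, q, r, s, h⟩ := (equiv_iff_exists_via f g).1 h
  suffices hq : Even q by
    obtain ⟨t, ht⟩ := hq
    exact ⟨p, t, r, s, by rwa [two_mul, ← ht]⟩
  obtain ⟨k, hk⟩ := hf.1.odd_b
  obtain ⟨⟨h1, -, -, ⟨A, hA⟩, ⟨C, hC⟩⟩, hf4⟩ := hf
  obtain ⟨⟨-, -, -, -, ⟨C', hC'⟩⟩, hg4⟩ := hg
  have e : f.c / 2 = C := by omega
  have e' : g.c / 2 = C' := by omega
  rw [e] at hf4
  rw [e'] at hg4
  obtain ⟨m, hm⟩ : ∃ m, n = 8 * m + 7 := ⟨n / 8, by omega⟩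
  have hA2 : Even A := by
    have : Even (A * C) := by
      rw [ClassicalForm.det, hA, hC, hk, hm] at h1
      push_cast at h1
      obtain ⟨j, hj⟩ := Int.even_mul_succ_self k
      have : 4 * (A * C) = 4 * (2 * (j + m + 1)) := by linear_combination 4 * hj - h1
      exact ⟨j + m + 1, by omega⟩
    rcases Int.even_mul.1 this with h | h
    · exact h
    · exact absurd h (Int.not_even_iff_odd.2 hf4)
  have h3 : C' = A * q ^ 2 + f.b * q * s + C * s ^ 2 := by
    have := h.2.2.2
    rw [hA, hC, hC'] at this
    have : 2 * C' = 2 * (A * q ^ 2 + f.b * q * s + C * s ^ 2) := by linear_combination this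
    omega
  have hb : ¬ Even f.b := Int.not_even_iff_odd.2 ⟨k, hk⟩
  rw [h3, ← Int.not_even_iff_odd] at hg4
  rw [← Int.not_even_iff_odd] at hf4
  by_contra hq
  apply hg4
  simp only [Int.even_add, Int.even_mul, Int.even_pow, hA2, hb, hf4, hq]
  simp

theorem IsE0.exists_via_even_of_three {f g : ClassicalForm}
    (hf : IsE0 3 f) (h : Equiv f g) :
    ∃ p q r s : ℤ, Via f g p (2 * q) r s := by
  obtain ⟨p, q, r, s, h⟩ := (equiv_iff_exists_via f g).1 h
  suffices hq : ∃ p q r s, Even q ∧ Via f g p q r s by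
    obtain ⟨p, q, r, s, ⟨t, ht⟩, h⟩ := hq
    exact ⟨p, t, r, s, by rwa [two_mul, ← ht]⟩
  obtain ⟨k, hk⟩ := hf.1.odd_b
  obtain ⟨⟨h1, -, -, ⟨A, hA⟩, ⟨C, hC⟩⟩, hf4⟩ := hf
  have e : f.c / 2 = C := by omega
  rw [e] at hf4
  rw [ClassicalForm.det, hA, hC, hk] at h1
  push_cast at h1
  have h1' : k ^ 2 + k - A * C = -1 := by
    have : 4 * (k ^ 2 + k - A * C) = 4 * (-1) := by linear_combination h1
    omega
  have aut : Via f f (-k) (-C) A (k + 1) := by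
    simp only [Via, hA, hC, hk]
    refine ⟨by linear_combination -h1', by linear_combination 2 * A * h1', ?_, ?_⟩
    · linear_combination (2 * k + 1) * h1'
    · linear_combination 2 * C * h1'
  have h' := aut.trans h
  have h'' := aut.trans h'
  by_cases hq : Even q
  · exact ⟨_, _, _, _, hq, h⟩
  by_cases hq' : Even (-k * q + -C * s)
  · exact ⟨_, _, _, _, hq', h'⟩
  refine ⟨_, _, _, _, ?_, h''⟩
  have : -k * (-k * q + -C * s) + -C * (A * q + (k + 1) * s) = (-k * q + -C * s) - q := by
    linear_combination q * h1'
  rw [this, Int.even_sub]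
  exact ⟨fun h => absurd h hq', fun h => absurd h hq⟩

/-- Automorphs of a primitive even form of determinant `-n` with `n > 4` are `±1`. -/
theorem IsE.eq_of_via_self {n : ℕ} (hn : 4 < n) {f : ClassicalForm} (hf : IsE n f)
    {p q r s : ℤ} (h : Via f f p q r s) : q = 0 ∧ r = 0 ∧ p = s := by
  obtain ⟨h1, -, ⟨x, y, z, hx⟩, ⟨A, hA⟩, ⟨C, hC⟩⟩ := hf
  obtain ⟨h0, ha, hb, hc⟩ := h
  rw [ClassicalForm.det, hA, hC] at h1
  simp only [hA, hC] at ha hb hc hx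
  generalize f.b = B at *
  have e1 : A * (s - p) = B * r := by
    have : 2 * (A * (s - p)) = 2 * (B * r) := by
      linear_combination s * ha - r * hb + (2 * A * p + B * r) * h0
    omega
  have e2 : A * q = -(C * r) := by
    have : 2 * (A * q) = 2 * (-(C * r)) := by
      linear_combination -s * hb + r * hc - (2 * A * q + B * s) * h0
    omega
  have e3 : C * (s - p) = -(B * q) := by
    have : 2 * (C * (s - p)) = 2 * (-(B * q)) := by
      linear_combination -p * hc + q * hb - (2 * C * s + B * q) * h0
    omega
  obtain ⟨u, hr, hs, hq⟩ : ∃ u, r = u * A ∧ s - p = u * B ∧ -q = u * C := by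
    refine ⟨2 * x * r + y * (s - p) - 2 * z * q, ?_, ?_, ?_⟩
    · linear_combination -r * hx - y * e1 + 2 * z * e2
    · linear_combination -(s - p) * hx + 2 * x * e1 + 2 * z * e3
    · linear_combination q * hx - 2 * x * e2 - y * e3
  have key : (p + s) ^ 2 + n * u ^ 2 = 4 := by
    linear_combination 4 * h0 + (s - p + u * B) * hs + u ^ 2 * h1 + 4 * q * hr - 4 * u * A * hq
  have hu : u = 0 := by
    by_contra hu
    have : 0 < u ^ 2 := by positivity
    have hn' : (5 : ℤ) ≤ n := by exact_mod_cast hn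
    nlinarith [sq_nonneg (p + s)]
  subst hu
  simp only [zero_mul] at hr hs hq
  exact ⟨by omega, hr, by omega⟩

theorem IsE.isE0_of_mod_eight {n : ℕ} (hn : n % 8 = 3) {f : ClassicalForm} (hf : IsE n f) :
    IsE0 n f := by
  refine ⟨hf, ?_⟩
  obtain ⟨k, hk⟩ := hf.odd_b
  obtain ⟨h1, -, -, ⟨A, hA⟩, ⟨C, hC⟩⟩ := hf
  rw [show f.c / 2 = C by omega]
  obtain ⟨m, hm⟩ : ∃ m, n = 8 * m + 3 := ⟨n / 8, by omega⟩
  rw [ClassicalForm.det, hA, hC, hk, hm] at h1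
  push_cast at h1
  by_contra hC'
  obtain ⟨i, hi⟩ := Int.not_odd_iff_even.1 hC'
  obtain ⟨j, hj⟩ := Int.even_mul_succ_self k
  rw [hi] at h1
  have : 8 * (j - A * i + m) = -4 := by linear_combination h1 - 4 * hj
  omega

theorem IsE.mod_four {n : ℕ} {f : ClassicalForm} (hf : IsE n f) : n % 4 = 3 := by
  obtain ⟨k, hk⟩ := hf.odd_b
  obtain ⟨h1, -, -, ⟨A, hA⟩, ⟨C, hC⟩⟩ := hf
  rw [ClassicalForm.det, hA, hC, hk] at h1
  have : (n : ℤ) = 4 * (A * C - k ^ 2 - k) - 1 := by linear_combination h1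
  omega

/-- The action of a matrix on a form. -/
def act (f : ClassicalForm) (p q r s : ℤ) : ClassicalForm :=
  ⟨f.a * p ^ 2 + 2 * f.b * p * r + f.c * r ^ 2,
    f.a * p * q + f.b * (p * s + q * r) + f.c * r * s,
    f.a * q ^ 2 + 2 * f.b * q * s + f.c * s ^ 2⟩

/-- Representatives of the cosets of the matrices with even upper right entry in `SL₂(ℤ)`. -/
def cosetForm (f : ClassicalForm) (i : Fin 3) : ClassicalForm :=
  f.act (![1, 1, 0] i) (![0, 1, -1] i) (![0, 0, 1] i) (![1, 1, 0] i)

theorem via_cosetForm (f : ClassicalForm) (i : Fin 3) :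
    Via f (f.cosetForm i) (![1, 1, 0] i) (![0, 1, -1] i) (![0, 0, 1] i) (![1, 1, 0] i) := by
  refine ⟨?_, rfl, rfl, rfl⟩
  fin_cases i <;> simp

/-- The setoid of proper equivalence on the forms satisfying a predicate. -/
def setoid (P : ClassicalForm → Prop) : Setoid {f // P f} :=
  ⟨fun f g => Equiv f.1 g.1, ⟨fun f => equivalence_equiv.refl f.1,
    fun h => equivalence_equiv.symm h, fun h h' => equivalence_equiv.trans h h'⟩⟩

theorem card_quotient_eq_of_ker_eq {α β γ : Type} (u : α → β) (v : α → γ)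
    (hu : Function.Surjective u) (hv : Function.Surjective v)
    (huv : ∀ x y, u x = u y ↔ v x = v y) : Nat.card β = Nat.card γ := by
  have : Setoid.ker u = Setoid.ker v := by
    ext x y
    exact huv x y
  exact Nat.card_congr ((Setoid.quotientKerEquivOfSurjective u hu).symm.trans
    ((Quotient.congrRight (fun x y => by rw [this])).trans
      (Setoid.quotientKerEquivOfSurjective v hv)))

end ClassicalForm

open ClassicalForm

theorem Ftil₁_eq_card {n : ℕ} (hn : 0 < n) :
    Ftil₁ n = Nat.card (Quotient (setoid (IsE n))) := by
  have : {f : ClassicalForm | f.det = -(n : ℤ) ∧ f.PosDef ∧ f.Primitive ∧ f.EvenForm} =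
      {f | IsE n f} := Set.ext (isE_iff hn)
  rw [Ftil₁, this]
  rfl

theorem Ftil_eq_card {n : ℕ} (hn : 0 < n) :
    Ftil n = Nat.card (Quotient (setoid (IsU n))) := by
  have : {f : ClassicalForm | f.det = -(n : ℤ) ∧ f.PosDef ∧ f.Primitive ∧ f.Uneven} =
      {f | IsU n f} := Set.ext (isU_iff hn)
  rw [Ftil, this]
  rfl

/-- The class of the restriction of an even form with odd half last coefficient. -/
def restrictClass (n : ℕ) (f : {f // IsE0 n f}) : Quotient (setoid (IsU n)) :=
  Quotient.mk _ ⟨f.1.restrict, f.2.isU_restrict⟩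

theorem restrictClass_eq_iff {n : ℕ} (f g : {f // IsE0 n f}) :
    restrictClass n f = restrictClass n g ↔ ∃ p q r s : ℤ, Via f.1 g.1 p (2 * q) r s := by
  rw [← restrict_equiv_iff f.2 g.2]
  exact Quotient.eq

theorem restrictClass_surjective {n : ℕ} (hn : n % 4 = 3) :
    Function.Surjective (restrictClass n) := by
  intro y
  induction y using Quotient.inductionOn with
  | h f =>
    obtain ⟨g, hg, h⟩ := f.2.exists_restrict (by omega) hn
    exact ⟨⟨g, hg⟩, Quotient.sound h⟩

theorem Ftil₁_eq_Ftil {n : ℕ} (h : n % 8 = 7 ∨ n = 3) : Ftil₁ n = Ftil n := by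
  have hn : 0 < n := by omega
  rw [Ftil₁_eq_card hn, Ftil_eq_card hn]
  refine card_quotient_eq_of_ker_eq
    (fun f : {f // IsE0 n f} => (Quotient.mk (setoid (IsE n)) ⟨f.1, f.2.1⟩)) (restrictClass n)
    ?_ (restrictClass_surjective (by omega)) ?_
  · intro y
    induction y using Quotient.inductionOn with
    | h f =>
      obtain ⟨g, hg, h⟩ := f.2.exists_isE0 hn
      exact ⟨⟨g, hg⟩, Quotient.sound (equivalence_equiv.symm h)⟩
  · intro f g
    rw [restrictClass_eq_iff]
    refine Quotient.eq.trans ⟨fun hfg => ?_, ?_⟩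
    · rcases h with h | rfl
      · exact f.2.exists_via_even_of_mod_eight h g.2 hfg
      · exact f.2.exists_via_even_of_three hfg
    · rintro ⟨p, q, r, s, h⟩
      exact (equiv_iff_exists_via _ _).2 ⟨_, _, _, _, h⟩

theorem three_mul_Ftil₁_eq_Ftil {n : ℕ} (h : n % 8 = 3) (h3 : n ≠ 3) :
    Ftil₁ n * 3 = Ftil n := by
  have hn : 0 < n := by omega
  rw [Ftil₁_eq_card hn, Ftil_eq_card hn]
  have hE (c : Quotient (setoid (IsE n))) (i : Fin 3) : IsE0 n (c.out.1.cosetForm i) :=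
    ((via_cosetForm c.out.1 i).isE hn c.out.2).isE0_of_mod_eight h
  let Φ : Quotient (setoid (IsE n)) × Fin 3 → Quotient (setoid (IsU n)) :=
    fun x => restrictClass n ⟨x.1.out.1.cosetForm x.2, hE x.1 x.2⟩
  have hΦ : Function.Bijective Φ := by
    constructor
    · rintro ⟨c, i⟩ ⟨d, j⟩ hcd
      obtain ⟨p, q, r, s, hv⟩ := (restrictClass_eq_iff _ _).1 hcd
      have hv' := ((via_cosetForm c.out.1 i).trans hv).trans (via_cosetForm d.out.1 j).symm
      have hcd' : c = d := by
        rw [← c.out_eq, ← d.out_eq]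
        exact Quotient.sound ((equiv_iff_exists_via _ _).2 ⟨_, _, _, _, hv'⟩)
      subst hcd'
      have := c.out.2.eq_of_via_self (by omega) hv'
      have hps : Odd (p * s) := ⟨q * r, by linear_combination hv.1⟩
      obtain ⟨⟨k, hk⟩, ⟨l, hl⟩⟩ := Int.odd_mul.1 hps
      simp only [Prod.mk.injEq, true_and]
      fin_cases i <;> fin_cases j <;> simp at this ⊢ <;> omega
    · intro y
      obtain ⟨f, rfl⟩ := restrictClass_surjective (by omega) y
      set c : Quotient (setoid (IsE n)) := Quotient.mk _ ⟨f.1, f.2.1⟩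
      have hcf : Equiv c.out.1 f.1 := Quotient.exact (s := setoid (IsE n)) c.out_eq
      obtain ⟨p, q, r, s, hv⟩ := (equiv_iff_exists_via _ _).1 hcf
      have key (i : Fin 3) (hi : Even ((![1, 1, 0] i : ℤ) * q + -(![0, 1, -1] i) * s)) :
          ∃ x, Φ x = restrictClass n f := by
        refine ⟨(c, i), (restrictClass_eq_iff _ _).2 ?_⟩
        obtain ⟨t, ht⟩ := hi
        have := (via_cosetForm c.out.1 i).symm.trans hv
        rw [ht, ← two_mul] at this
        exact ⟨_, _, _, _, this⟩
      by_cases hq : Even q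
      · exact key 0 (by simpa using hq)
      by_cases hs : Even s
      · exact key 2 (by simpa using hs)
      · exact key 1 (by simp [Int.even_add, hq, hs])
  rw [← Nat.card_eq_of_bijective Φ hΦ, Nat.card_prod, Nat.card_fin]

/-- Gauss: `F̃₁(n) = F̃(n)` when `n ≡ 7 (mod 8)` or `n = 3`;
`F̃₁(n) = F̃(n)/3` when `n ≡ 3 (mod 8)` and `n ≠ 3`; and `F̃₁(n) = 0` when
`n ≢ 3 (mod 4)`. -/
theorem gauss_Ftil₁ (n : ℕ) (hn : 0 < n) :
    ((n % 8 = 7 ∨ n = 3) → Ftil₁ n = Ftil n) ∧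
    ((n % 8 = 3 ∧ n ≠ 3) → (Ftil₁ n : ℚ) = (Ftil n : ℚ) / 3) ∧
    (n % 4 ≠ 3 → Ftil₁ n = 0) := by
  refine ⟨Ftil₁_eq_Ftil, fun h => ?_, fun h => ?_⟩
  · rw [← three_mul_Ftil₁_eq_Ftil h.1 h.2]
    push_cast
    ring
  · rw [Ftil₁_eq_card hn]
    have : IsEmpty {f // IsE n f} := ⟨fun f => h f.2.mod_four⟩
    have : IsEmpty (Quotient (setoid (IsE n))) := Quotient.instIsEmpty
    exact Nat.card_of_isEmpty
end

section
/- Let R be a commutative ring, B a positive integer, and f, g ∈ R[x]. For i ≥ 0 define the block polynomials F_i(y) = Σ_{j=0}^{B−1} f_{iB+j} y^j and G_i(y) = Σ_{j=0}^{B−1} g_{iB+j} y^j, where f_k, g_k denote the coefficients of f and g, and set H_n(y) = Σ_{i=0}^{n} F_i(y) G_{n−i}(y) for n ≥ 0 and H_{−1}(y) = 0. Then for every k ≥ 0, the coefficient of x^k in f·g equals the coefficient of y^{k mod B} in H_{⌊k/B⌋} plus the coefficient of y^{(k mod B) + B} in H_{⌊k/B⌋ − 1}. -/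
open Finset Polynomial in
theorem coeff_sum_C_mul_X_pow_range {R : Type*} [CommRing R] (B : ℕ) (a : ℕ → R) (m : ℕ) :
    (∑ j ∈ range B, C (a j) * X ^ j : R[X]).coeff m = if m < B then a m else 0 := by
  simp [coeff_C_mul, coeff_X_pow]

open Finset Polynomial in
/-- The coefficients of a block convolution collect the products `f_a * g_b` whose
remainders modulo `B` add up to the exponent. -/
theorem coeff_block_convolution {R : Type*} [CommRing R] {B : ℕ} (hB : 0 < B)
    (f g : R[X]) (n m : ℕ) :
    (∑ i ∈ range (n + 1), (∑ j ∈ range B, C (f.coeff (i * B + j)) * X ^ j) *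
        ∑ j ∈ range B, C (g.coeff ((n - i) * B + j)) * X ^ j : R[X]).coeff m =
      ∑ p ∈ antidiagonal (n * B + m) with p.1 % B + p.2 % B = m,
        f.coeff p.1 * g.coeff p.2 := by
  rw [← Nat.sum_antidiagonal_eq_sum_range_succ
    (fun i i' ↦ (∑ j ∈ range B, C (f.coeff (i * B + j)) * X ^ j) *
        ∑ j ∈ range B, C (g.coeff (i' * B + j)) * X ^ j : ℕ → ℕ → R[X])]
  simp only [finsetSum_coeff (antidiagonal n), coeff_mul, coeff_sum_C_mul_X_pow_range,
    ite_zero_mul_ite_zero]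
  rw [← sum_product', ← sum_filter]
  symm
  refine sum_nbij' (fun p ↦ ((p.1 / B, p.2 / B), (p.1 % B, p.2 % B)))
    (fun q ↦ (q.1.1 * B + q.2.1, q.1.2 * B + q.2.2)) ?_ ?_ ?_ ?_ ?_
  · rintro ⟨a, b⟩ h
    simp only [mem_filter, HasAntidiagonal.mem_antidiagonal, mem_product] at h ⊢
    obtain ⟨hab, hm⟩ := h
    have ha := Nat.div_add_mod' a B
    have hb := Nat.div_add_mod' b B
    refine ⟨⟨Nat.eq_of_mul_eq_mul_right hB ?_, hm⟩, Nat.mod_lt _ hB, Nat.mod_lt _ hB⟩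
    rw [add_mul]
    omega
  · rintro ⟨⟨i, i'⟩, j, j'⟩ h
    simp only [mem_filter, HasAntidiagonal.mem_antidiagonal, mem_product] at h ⊢
    obtain ⟨⟨rfl, rfl⟩, hj, hj'⟩ := h
    refine ⟨by ring, ?_⟩
    simp [Nat.mod_eq_of_lt hj, Nat.mod_eq_of_lt hj']
  · rintro ⟨a, b⟩ -
    simp [Nat.div_add_mod']
  · rintro ⟨⟨i, i'⟩, j, j'⟩ h
    simp only [mem_filter, HasAntidiagonal.mem_antidiagonal, mem_product] at h
    obtain ⟨-, hj, hj'⟩ := h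
    simp [Nat.mod_eq_of_lt, Nat.add_div_of_dvd_right, hj, hj', hB]
  · rintro ⟨a, b⟩ -
    simp [Nat.div_add_mod']

/-- coefficient recovery for Kronecker substitution: let `R` be a
commutative ring, `B > 0`, and `f, g ∈ R[x]`.  With block polynomials
`F_i(y) = Σ_{j<B} f_{iB+j} y^j`, `G_i(y) = Σ_{j<B} g_{iB+j} y^j` and
`H_n = Σ_{i=0}^n F_i G_{n-i}` (and `H_{-1} = 0`), the coefficient of `x^k` in
`f·g` equals the coefficient of `y^{k mod B}` in `H_{⌊k/B⌋}` plus the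
coefficient of `y^{(k mod B) + B}` in `H_{⌊k/B⌋ - 1}`. -/
theorem kronecker_substitution_coeff (R : Type*) [CommRing R] (B : ℕ) (hB : 0 < B)
    (f g : Polynomial R) (Fb Gb : ℕ → Polynomial R)
    (hF : ∀ i, Fb i = ∑ j ∈ Finset.range B,
      Polynomial.C (f.coeff (i * B + j)) * Polynomial.X ^ j)
    (hG : ∀ i, Gb i = ∑ j ∈ Finset.range B,
      Polynomial.C (g.coeff (i * B + j)) * Polynomial.X ^ j)
    (H : ℕ → Polynomial R)
    (hH : ∀ n, H n = ∑ i ∈ Finset.range (n + 1), Fb i * Gb (n - i)) :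
    ∀ k : ℕ, (f * g).coeff k =
      (H (k / B)).coeff (k % B) +
        (if k / B = 0 then 0 else (H (k / B - 1)).coeff (k % B + B)) := by
  intro k
  have hcoeff (n m : ℕ) : (H n).coeff m =
      ∑ p ∈ Finset.HasAntidiagonal.antidiagonal (n * B + m) with p.1 % B + p.2 % B = m,
        f.coeff p.1 * g.coeff p.2 := by
    rw [hH]
    simp only [hF, hG]
    exact coeff_block_convolution hB f g n m
  have hmod {p : ℕ × ℕ} (hp : p.1 + p.2 = k) :
      p.1 % B + p.2 % B = if p.1 % B + p.2 % B < B then k % B else k % B + B := by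
    subst hp
    have := Nat.add_mod_add_ite p.1 p.2 B
    split_ifs at this ⊢ <;> omega
  rw [Polynomial.coeff_mul, hcoeff, Nat.div_add_mod',
    ← Finset.sum_filter_add_sum_filter_not _ (fun p : ℕ × ℕ ↦ p.1 % B + p.2 % B = k % B)]
  congr 1
  split_ifs with hk
  · refine Finset.sum_eq_zero fun p hp ↦ ?_
    simp only [Finset.mem_filter, Finset.HasAntidiagonal.mem_antidiagonal] at hp
    have hkB : k < B := (Nat.div_eq_zero_iff_lt hB).mp hk
    have := Nat.mod_le p.1 B
    have := Nat.mod_le p.2 B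
    have := hmod hp.1
    split_ifs at this <;> omega
  · have hkB : (k / B - 1) * B + (k % B + B) = k := by
      obtain ⟨q, hq⟩ := Nat.exists_eq_succ_of_ne_zero hk
      have := Nat.div_add_mod' k B
      rw [hq, Nat.succ_mul] at this
      rw [hq, Nat.succ_sub_one]
      omega
    rw [hcoeff, hkB]
    refine Finset.sum_congr (Finset.filter_congr fun p hp ↦ ?_) fun _ _ ↦ rfl
    have := hmod (Finset.HasAntidiagonal.mem_antidiagonal.mp hp)
    split_ifs at this <;> omega
end

section
/- Let X ≥ 1 be an integer and let Δ be a negative integer with Δ ≡ 0 or 1 (mod 4) and 8X + Δ ≥ 0. Set Y = ⌊√(8X + Δ)⌋ and let r(Δ, X) be the number of pairs of integers (t, n) with t ≥ 1 and 1 ≤ n ≤ X such that Δ = t² − 8n. Then r(Δ, X) = 0 if Δ ≡ 5 (mod 8); r(Δ, X) = ⌊(Y+1)/2⌋ if Δ ≡ 1 (mod 8); r(Δ, X) = ⌊(Y+2)/4⌋ if Δ ≡ 4 (mod 8); and r(Δ, X) = ⌊Y/4⌋ if Δ ≡ 0 (mod 8). -/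
theorem card_Icc_filter_emod_eq {m c Y : ℤ} (hm : 0 < m) (hc : 1 ≤ c) (hcm : c ≤ m)
    (hY : 0 ≤ Y) :
    (((Finset.Icc 1 Y).filter fun t ↦ t % m = c % m).card : ℤ) = (Y + m - c) / m := by
  have himage : (Finset.Icc 1 Y).filter (fun t ↦ t % m = c % m) =
      (Finset.Icc 1 ((Y + m - c) / m)).image fun k ↦ m * k + c - m := by
    ext t
    simp only [Finset.mem_filter, Finset.mem_Icc, Finset.mem_image, Int.le_ediv_iff_mul_le hm]
    constructor
    · rintro ⟨⟨h1, hY⟩, h⟩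
      obtain ⟨k, hk⟩ := Int.ModEq.dvd (Int.ModEq.symm h)
      refine ⟨k + 1, ⟨?_, by nlinarith⟩, by linarith⟩
      by_contra! hlt
      nlinarith
    · rintro ⟨k, ⟨h1, hk⟩, rfl⟩
      refine ⟨⟨by nlinarith, by linarith⟩, ?_⟩
      exact (Int.modEq_iff_dvd.2 ⟨k - 1, by ring⟩ : c ≡ m * k + c - m [ZMOD m]).symm
  rw [himage, Finset.card_image_of_injective, Int.card_Icc]
  · have : 0 ≤ (Y + m - c) / m := Int.ediv_nonneg (by linarith) hm.le
    omega
  · intro a b hab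
    exact mul_left_cancel₀ hm.ne' (by dsimp only at hab; linarith)

theorem le_intSqrt_iff_sq_le {t a : ℤ} (ht : 0 ≤ t) (ha : 0 ≤ a) :
    t ≤ Int.sqrt a ↔ t ^ 2 ≤ a := by
  lift t to ℕ using ht
  lift a to ℕ using ha
  simp only [Int.sqrt, Int.toNat_natCast]
  norm_cast
  exact Nat.le_sqrt'

theorem card_representations_eq {X Δ : ℤ} (hneg : Δ < 0) (hXΔ : 0 ≤ 8 * X + Δ) :
    Nat.card {p : ℤ × ℤ // 1 ≤ p.1 ∧ 1 ≤ p.2 ∧ p.2 ≤ X ∧ Δ = p.1 ^ 2 - 8 * p.2} =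
      ((Finset.Icc 1 (Int.sqrt (8 * X + Δ))).filter fun t ↦ t ^ 2 % 8 = Δ % 8).card := by
  rw [← Nat.card_eq_finsetCard]
  refine Nat.card_congr
    { toFun := fun p ↦ ⟨p.1.1, ?_⟩
      invFun := fun t ↦ ⟨(t.1, (t.1 ^ 2 - Δ) / 8), ?_⟩
      left_inv := ?_
      right_inv := fun _ ↦ rfl }
  · obtain ⟨⟨t, n⟩, ht, hn, hnX, h⟩ := p
    dsimp only at ht hn hnX h ⊢
    rw [Finset.mem_filter, Finset.mem_Icc, le_intSqrt_iff_sq_le (by linarith) hXΔ]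
    exact ⟨⟨ht, by linarith⟩, by omega⟩
  · obtain ⟨t, ht⟩ := t
    rw [Finset.mem_filter, Finset.mem_Icc] at ht
    obtain ⟨⟨h1, hle⟩, hmod⟩ := ht
    rw [le_intSqrt_iff_sq_le (by linarith) hXΔ] at hle
    have hsq : 0 ≤ t ^ 2 := sq_nonneg t
    refine ⟨h1, ?_, ?_, ?_⟩ <;> dsimp only <;> omega
  · rintro ⟨⟨t, n⟩, ht, hn, hnX, h⟩
    simp only [Subtype.mk.injEq, Prod.mk.injEq, true_and]
    dsimp only at h
    omega

theorem sq_emod_eight (t : ℤ) :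
    t % 4 = 0 ∧ t ^ 2 % 8 = 0 ∨ t % 4 = 2 ∧ t ^ 2 % 8 = 4 ∨ t % 2 = 1 ∧ t ^ 2 % 8 = 1 := by
  have h : t % 8 = 0 ∨ t % 8 = 1 ∨ t % 8 = 2 ∨ t % 8 = 3 ∨ t % 8 = 4 ∨ t % 8 = 5 ∨
      t % 8 = 6 ∨ t % 8 = 7 := by omega
  rcases h with h | h | h | h | h | h | h | h <;> simp [pow_two, Int.mul_emod, h] <;> omega


/-- let `X ≥ 1`, let `Δ < 0` with `Δ ≡ 0` or `1 (mod 4)` and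
`8X + Δ ≥ 0`, set `Y = ⌊√(8X + Δ)⌋`, and let `r(Δ, X)` be the number of pairs
of integers `(t, n)` with `t ≥ 1`, `1 ≤ n ≤ X` and `Δ = t² - 8n`.  Then
`r(Δ, X) = 0` if `Δ ≡ 5 (mod 8)`, `r(Δ, X) = ⌊(Y+1)/2⌋` if `Δ ≡ 1 (mod 8)`,
`r(Δ, X) = ⌊(Y+2)/4⌋` if `Δ ≡ 4 (mod 8)`, and `r(Δ, X) = ⌊Y/4⌋` if
`Δ ≡ 0 (mod 8)`. -/
theorem count_representations (X : ℤ) (hX : 1 ≤ X) (Δ : ℤ) (hneg : Δ < 0)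
    (hmod : Δ % 4 = 0 ∨ Δ % 4 = 1) (hXΔ : 0 ≤ 8 * X + Δ)
    (Y : ℤ) (hY : Y = Int.sqrt (8 * X + Δ))
    (r : ℕ)
    (hr : r = Nat.card {p : ℤ × ℤ // 1 ≤ p.1 ∧ 1 ≤ p.2 ∧ p.2 ≤ X ∧
      Δ = p.1 ^ 2 - 8 * p.2}) :
    (Δ % 8 = 5 → (r : ℤ) = 0) ∧
    (Δ % 8 = 1 → (r : ℤ) = (Y + 1) / 2) ∧
    (Δ % 8 = 4 → (r : ℤ) = (Y + 2) / 4) ∧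
    (Δ % 8 = 0 → (r : ℤ) = Y / 4) := by
  have hYnonneg : 0 ≤ Y := hY ▸ Int.sqrt_nonneg _
  rw [card_representations_eq hneg hXΔ, ← hY] at hr
  subst hr
  refine ⟨fun h ↦ ?_, fun h ↦ ?_, fun h ↦ ?_, fun h ↦ ?_⟩
  · rw [Nat.cast_eq_zero, Finset.card_eq_zero, Finset.filter_eq_empty_iff]
    intro t _
    have := sq_emod_eight t
    omega
  · rw [Finset.filter_congr (q := fun t ↦ t % 2 = 1 % 2) fun t _ ↦ by
      have := sq_emod_eight t
      omega, card_Icc_filter_emod_eq (by norm_num) (by norm_num) (by norm_num) hYnonneg]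
    congr 1
    ring
  · rw [Finset.filter_congr (q := fun t ↦ t % 4 = 2 % 4) fun t _ ↦ by
      have := sq_emod_eight t
      omega, card_Icc_filter_emod_eq (by norm_num) (by norm_num) (by norm_num) hYnonneg]
    congr 1
    ring
  · rw [Finset.filter_congr (q := fun t ↦ t % 4 = 4 % 4) fun t _ ↦ by
      have := sq_emod_eight t
      omega, card_Icc_filter_emod_eq (by norm_num) (by norm_num) (by norm_num) hYnonneg]
    congr 1
    ring
end

section
/- Let a, b > 0 be real numbers and assume that h_ω(Δ) ≤ (1/π)·√|Δ|·(a·log|Δ| + b) for every negative integer Δ ≡ 0 or 1 (mod 4). Then for every integer n ≥ 3 with −n ≡ 0 or 1 (mod 4), letting g be the largest positive integer such that g² divides n, the Hurwitz class number satisfies H(n) ≤ (1/π)·√n·(a·log n + b)·Σ_{t | g} 1/t. -/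
open scoped Classical

/-- Every `t` with `t² ∣ n` divides the largest such `t`. -/
theorem dvd_of_isGreatest_sq_dvd {n g t : ℕ}
    (hg : IsGreatest {t : ℕ | 0 < t ∧ t ^ 2 ∣ n} g) (ht : 0 < t) (htn : t ^ 2 ∣ n) : t ∣ g := by
  obtain ⟨⟨hg0, hgn⟩, hmax⟩ := hg
  have hle : Nat.lcm t g ≤ g :=
    hmax ⟨Nat.lcm_pos ht hg0, by rw [← Nat.pow_lcm_pow]; exact Nat.lcm_dvd htn hgn⟩
  have heq : Nat.lcm t g = g :=
    le_antisymm hle (Nat.le_of_dvd (Nat.lcm_pos ht hg0) (Nat.dvd_lcm_right t g))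
  exact heq ▸ Nat.dvd_lcm_left t g

/-- if `h_ω(Δ) ≤ (1/π) √|Δ| (a log|Δ| + b)` for every negative
discriminant `Δ`, then for every `n ≥ 3` with `-n ≡ 0` or `1 (mod 4)`, letting
`g` be the largest positive integer with `g² ∣ n`, the Hurwitz class number
satisfies `H(n) ≤ (1/π) √n (a log n + b) Σ_{t ∣ g} 1/t`. -/
theorem hurwitz_upper_bound (a b : ℝ) (ha : 0 < a) (hb : 0 < b)
    (hyp : ∀ Δ : ℤ, Δ < 0 → (Δ % 4 = 0 ∨ Δ % 4 = 1) →
      ((hω Δ : ℚ) : ℝ) ≤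
        (1 / Real.pi) * Real.sqrt |(Δ : ℝ)| * (a * Real.log |(Δ : ℝ)| + b))
    (n : ℕ) (hn : 3 ≤ n) (hmod : (-(n : ℤ)) % 4 = 0 ∨ (-(n : ℤ)) % 4 = 1)
    (g : ℕ) (hg : IsGreatest {t : ℕ | 0 < t ∧ t ^ 2 ∣ n} g) :
    ((Hur n : ℚ) : ℝ) ≤
      (1 / Real.pi) * Real.sqrt (n : ℝ) * (a * Real.log (n : ℝ) + b) *
        ∑ t ∈ g.divisors, (1 : ℝ) / (t : ℝ) := by
  have hn1 : (1 : ℝ) ≤ n := by exact_mod_cast (by omega : 1 ≤ n)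
  have hlog : 0 ≤ Real.log n := Real.log_nonneg hn1
  rw [Hur, Rat.cast_sum, Finset.mul_sum]
  refine (Finset.sum_le_sum (g := fun t : ℕ => (1 / Real.pi) * Real.sqrt (n : ℝ) *
    (a * Real.log (n : ℝ) + b) * ((1 : ℝ) / (t : ℝ))) ?_).trans
    (Finset.sum_le_sum_of_subset_of_nonneg ?_ fun t _ _ => by positivity)
  · intro t ht
    simp only [Finset.mem_filter, Finset.mem_Icc] at ht
    obtain ⟨⟨ht1, -⟩, ⟨m, hm⟩, hmod4⟩ := ht
    have ht0 : 0 < t ^ 2 := by positivity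
    have hdiv : n / t ^ 2 = m := by rw [hm, Nat.mul_div_cancel_left _ ht0]
    rw [hdiv] at hmod4 ⊢
    have hm0 : 0 < m := Nat.pos_of_ne_zero (by rintro rfl; omega)
    have hmn : m ≤ n := hm ▸ Nat.le_mul_of_pos_left m ht0
    have hm0' : (0 : ℝ) < m := by exact_mod_cast hm0
    have htR : (0 : ℝ) < t := by exact_mod_cast ht1
    have key := hyp (-(m : ℤ)) (by omega) hmod4
    have habs : |((-(m : ℤ) : ℤ) : ℝ)| = m := by
      push_cast
      rw [abs_neg, abs_of_pos hm0']
    rw [habs] at key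
    have hsqrt : Real.sqrt n = t * Real.sqrt m := by
      rw [hm]
      push_cast
      rw [Real.sqrt_mul (by positivity), Real.sqrt_sq htR.le]
    have hlogle : Real.log m ≤ Real.log n :=
      Real.log_le_log hm0' (by exact_mod_cast hmn)
    calc ((hω (-(m : ℤ)) : ℚ) : ℝ)
        ≤ (1 / Real.pi) * Real.sqrt m * (a * Real.log m + b) := key
      _ ≤ (1 / Real.pi) * Real.sqrt m * (a * Real.log n + b) := by gcongr
      _ = (1 / Real.pi) * Real.sqrt n * (a * Real.log n + b) * (1 / t) := by
        rw [hsqrt]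
        field_simp
  · intro t ht
    simp only [Finset.mem_filter, Finset.mem_Icc] at ht
    exact Nat.mem_divisors.mpr
      ⟨dvd_of_isGreatest_sq_dvd hg ht.1.1 ht.2.1, hg.1.1.ne'⟩
end
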